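/- Let g be a nilpotent Lie algebra with nilindex p, and let f : 𝒳 × 𝒲 → 𝒳 belong to class-𝒜 with linear part A, such that (i) for every W ∈ 𝒲, f(X,W) = 0 if and only if X = 0, and (ii) for every i ≥ 1 the subspace (g^(i))^n ⊆ 𝒳 is invariant under f (equivalently, under A). If there exist β ≥ 0 and s ≥ 1 such that the exogenous signal satisfies ‖W[k]‖ ≤ β·s^k for all k ≥ 0, and ρ(A) < s^{p(1−p)/2}, then the origin of 𝒳 is semiglobally exponentially stable for the system X[k+1] = f(X[k],W[k]). -/

import Mathlib

open scoped BigOperators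

/-- Words of length at least `2` over `m` letters. -/
def Word (m : ℕ) : Type := {l : List (Fin m) // 2 ≤ l.length}

section bracket

variable {g : Type*} [AddCommGroup g] [Module ℝ g]

/-- Right-nested evaluation `[Y ω₁, [Y ω₂, [… , Y ω_{|ω|}]⋯]]` of a word with respect to a
bilinear bracket `B`. -/
def wordEval (B : g →ₗ[ℝ] g →ₗ[ℝ] g) {m : ℕ} (Y : Fin m → g) : List (Fin m) → g
  | [] => 0
  | [i] => Y i
  | i :: j :: l => B (Y i) (wordEval B Y (j :: l))

/-- The `j`-th letter: `X j` for `j < n`, and `W (j - n)` otherwise. -/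
def letter {n r : ℕ} (X : Fin n → g) (W : Fin r → g) (j : Fin (n + r)) : g :=
  if h : (j : ℕ) < n then X ⟨j, h⟩ else W ⟨(j : ℕ) - n, by have := j.isLt; omega⟩

/-- Bracket of two submodules: the span of the pairwise brackets. -/
def bSpan (B : g →ₗ[ℝ] g →ₗ[ℝ] g) (S T : Submodule ℝ g) : Submodule ℝ g :=
  Submodule.span ℝ {z | ∃ x ∈ S, ∃ y ∈ T, z = B x y}

/-- `lcs B h i` is the `(i+1)`-st term `h^(i+1)` of the lower central series of `h`:
`h^(1) = h`, `h^(i+1) = [h^(i), h]`. -/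
def lcs (B : g →ₗ[ℝ] g →ₗ[ℝ] g) (h : Submodule ℝ g) : ℕ → Submodule ℝ g
  | 0 => h
  | i + 1 => bSpan B (lcs B h i) h

/-- The derived series of `g` with respect to the bracket `B`. -/
def derSeries (B : g →ₗ[ℝ] g →ₗ[ℝ] g) : ℕ → Submodule ℝ g
  | 0 => ⊤
  | i + 1 => bSpan B (derSeries B i) (derSeries B i)

end bracket

/-- The product norm `‖(Z₁, …, Z_m)‖ = Σ_i ‖Z_i‖`. -/
noncomputable def pnorm {g : Type*} [NormedAddCommGroup g] {m : ℕ} (X : Fin m → g) : ℝ :=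
  ∑ i, ‖X i‖

/-- The spectral radius of a (continuous) linear endomorphism, via Gelfand's formula. -/
noncomputable def specRad {E : Type*} [NormedAddCommGroup E] [NormedSpace ℝ E]
    (A : E →L[ℝ] E) : ℝ :=
  Filter.limsup (fun k : ℕ => ‖A ^ k‖ ^ (1 / (k : ℝ))) Filter.atTop

lemma letter_zero {g : Type*} [AddCommGroup g] {n r : ℕ} : letter (0 : Fin n → g) (0 : Fin r → g) = 0 := by
  ext a
  unfold letter
  split_ifs <;> rfl

section nilpotentWords

variable {g : Type*} [AddCommGroup g] [Module ℝ g] {B : g →ₗ[ℝ] g →ₗ[ℝ] g}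

lemma lcs_succ_le (B : g →ₗ[ℝ] g →ₗ[ℝ] g) (i : ℕ) : lcs B ⊤ (i + 1) ≤ lcs B ⊤ i := by
  induction i with
  | zero => exact le_top
  | succ i ih =>
    refine Submodule.span_mono ?_
    rintro z ⟨x, hx, y, hy, rfl⟩
    exact ⟨x, ih hx, y, hy, rfl⟩

lemma lcs_antitone (B : g →ₗ[ℝ] g →ₗ[ℝ] g) : Antitone (lcs B ⊤) :=
  antitone_nat_of_succ_le (lcs_succ_le B)

lemma bracket_mem_lcs_left {i : ℕ} {x : g} (hx : x ∈ lcs B ⊤ i) (y : g) :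
    B x y ∈ lcs B ⊤ (i + 1) :=
  Submodule.subset_span ⟨x, hx, y, trivial, rfl⟩

lemma bracket_mem_lcs_right (hB : B.IsAlt) {i : ℕ} {x : g} (hx : x ∈ lcs B ⊤ i) (y : g) :
    B y x ∈ lcs B ⊤ (i + 1) := by
  rw [← hB.neg]
  exact neg_mem (bracket_mem_lcs_left hx y)

lemma wordEval_cons_mem_lcs (hB : B.IsAlt) {m : ℕ} (Y : Fin m → g) (l : List (Fin m)) :
    ∀ a, wordEval B Y (a :: l) ∈ lcs B ⊤ l.length := by
  induction l with
  | nil => exact fun _ => trivial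
  | cons b l ih => exact fun a => bracket_mem_lcs_right hB (ih b) _

lemma wordEval_eq_zero (hB : B.IsAlt) {m p : ℕ} (hp : lcs B ⊤ p = ⊥) (Y : Fin m → g)
    {l : List (Fin m)} (hl : p < l.length) : wordEval B Y l = 0 := by
  cases l with
  | nil => simp at hl
  | cons a l =>
    have h := lcs_antitone B (Nat.lt_succ_iff.mp hl) (wordEval_cons_mem_lcs hB Y l a)
    simpa [hp] using h

lemma wordEval_zero {m : ℕ} (l : List (Fin m)) : wordEval B (0 : Fin m → g) l = 0 := by
  match l with
  | [] => rfl
  | [_] => rfl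
  | _ :: _ :: _ => simp [wordEval]

lemma wordEval_cons_sub_mem (hB : B.IsAlt) {m i : ℕ} {U V : Fin m → g}
    (h : ∀ a, U a - V a ∈ lcs B ⊤ i) (l : List (Fin m)) :
    ∀ a, wordEval B U (a :: l) - wordEval B V (a :: l) ∈ lcs B ⊤ i ∧
      (l ≠ [] → wordEval B U (a :: l) - wordEval B V (a :: l) ∈ lcs B ⊤ (i + 1)) := by
  induction l with
  | nil => exact fun a => ⟨h a, fun h => absurd rfl h⟩
  | cons b l ih =>
    intro a
    have key : wordEval B U (a :: b :: l) - wordEval B V (a :: b :: l) ∈ lcs B ⊤ (i + 1) := by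
      have e : wordEval B U (a :: b :: l) - wordEval B V (a :: b :: l)
          = B (U a - V a) (wordEval B U (b :: l))
            + B (V a) (wordEval B U (b :: l) - wordEval B V (b :: l)) := by
        simp [wordEval]
      rw [e]
      exact add_mem (bracket_mem_lcs_left (h a) _) (bracket_mem_lcs_right hB (ih b).1 _)
    exact ⟨lcs_succ_le B i key, fun _ => key⟩

lemma wordEval_sub_mem (hB : B.IsAlt) {m i : ℕ} {U V : Fin m → g}
    (h : ∀ a, U a - V a ∈ lcs B ⊤ i) (ω : Word m) :
    wordEval B U ω.1 - wordEval B V ω.1 ∈ lcs B ⊤ (i + 1) := by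
  obtain ⟨_ | ⟨a, _ | ⟨b, l⟩⟩, hl⟩ := ω
  · simp at hl
  · simp at hl
  · exact (wordEval_cons_sub_mem hB h (b :: l) a).2 (by simp)

lemma letter_sub_mem {n r : ℕ} {S : Submodule ℝ g} {X Y : Fin n → g} (W : Fin r → g)
    (h : ∀ j, X j - Y j ∈ S) (a : Fin (n + r)) : letter X W a - letter Y W a ∈ S := by
  unfold letter
  split_ifs
  · exact h _
  · simp

/-- Words of length at most `p`. -/
noncomputable def shortWords (m p : ℕ) : Finset (Word m) :=
  ((List.finite_length_le (Fin m) p).preimage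
    (Subtype.val_injective (p := fun l : List (Fin m) => 2 ≤ l.length)).injOn).toFinset

lemma mem_shortWords {m p : ℕ} {ω : Word m} : ω ∈ shortWords m p ↔ ω.1.length ≤ p := by
  exact Set.Finite.mem_toFinset _

/-- The short words of a class-𝒜 series, with the contribution of the purely exogenous words
subtracted. -/
noncomputable def wordSum (B : g →ₗ[ℝ] g →ₗ[ℝ] g) {n r : ℕ} (c : Word (n + r) → Fin n → ℝ) (p : ℕ)
    (X : Fin n → g) (W : Fin r → g) (j : Fin n) : g :=
  ∑ ω ∈ shortWords (n + r) p,
    c ω j • (wordEval B (letter X W) ω.1 - wordEval B (letter 0 W) ω.1)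

lemma wordSum_sub_mem (hB : B.IsAlt) {n r : ℕ} (c : Word (n + r) → Fin n → ℝ) {p i : ℕ}
    (hip : i < p) {X Y : Fin n → g} (W : Fin r → g) (h : ∀ j, X j - Y j ∈ lcs B ⊤ i)
    (j : Fin n) : wordSum B c p X W j - wordSum B c (i + 1) Y W j ∈ lcs B ⊤ (i + 1) := by
  have hsub : shortWords (n + r) (i + 1) ⊆ shortWords (n + r) p := fun ω hω => by
    rw [mem_shortWords] at hω ⊢
    omega
  classical
  unfold wordSum
  rw [← Finset.sum_sdiff hsub, add_sub_assoc, ← Finset.sum_sub_distrib]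
  refine add_mem (sum_mem fun ω hω => Submodule.smul_mem _ _ ?_) (sum_mem fun ω _ => ?_)
  · have hlen : i + 1 < ω.1.length := by
      simpa [mem_shortWords] using (Finset.mem_sdiff.mp hω).2
    have hmem : ∀ Z : Fin (n + r) → g, wordEval B Z ω.1 ∈ lcs B ⊤ (i + 1) := by
      intro Z
      obtain ⟨_ | ⟨a, l⟩, hl⟩ := ω
      · simp at hl
      · exact lcs_antitone B (Nat.lt_succ_iff.mp hlen) (wordEval_cons_mem_lcs hB Z l a)
    exact sub_mem (hmem _) (hmem _)
  · rw [← smul_sub, sub_sub_sub_cancel_right]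
    exact Submodule.smul_mem _ _ (wordEval_sub_mem hB (letter_sub_mem W h) ω)

end nilpotentWords

section norms

variable {g : Type*} [NormedAddCommGroup g]

lemma norm_letter_le {n r : ℕ} {X : Fin n → g} {W : Fin r → g} {T : ℝ} (hX : ‖X‖ ≤ T)
    (hW : ‖W‖ ≤ T) (a : Fin (n + r)) : ‖letter X W a‖ ≤ T := by
  unfold letter
  split_ifs
  · exact (norm_le_pi_norm _ _).trans hX
  · exact (norm_le_pi_norm _ _).trans hW

lemma norm_letter_sub_le {n r : ℕ} (X : Fin n → g) (W : Fin r → g) (a : Fin (n + r)) :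
    ‖letter X W a - letter 0 W a‖ ≤ ‖X‖ := by
  unfold letter
  split_ifs
  · simpa using norm_le_pi_norm X _
  · simp

lemma norm_le_pnorm {m : ℕ} (X : Fin m → g) : ‖X‖ ≤ pnorm X :=
  (pi_norm_le_iff_of_nonneg (Finset.sum_nonneg fun _ _ => norm_nonneg _)).mpr fun j =>
    Finset.single_le_sum (f := fun j => ‖X j‖) (fun _ _ => norm_nonneg _) (Finset.mem_univ j)

lemma pnorm_le {m : ℕ} (X : Fin m → g) : pnorm X ≤ m * ‖X‖ :=
  (Finset.sum_le_sum fun j _ => norm_le_pi_norm X j).trans (by simp)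

end norms

section estimates

variable {g : Type*} [NormedAddCommGroup g] [NormedSpace ℝ g] {B : g →ₗ[ℝ] g →ₗ[ℝ] g} {μ : ℝ}

lemma norm_wordEval_cons_le (hμ0 : 0 ≤ μ) (hμ : ∀ x y : g, ‖B x y‖ ≤ μ * ‖x‖ * ‖y‖) {m : ℕ}
    {Y : Fin m → g} {T : ℝ} (hY : ∀ a, ‖Y a‖ ≤ T) (l : List (Fin m)) :
    ∀ a, ‖wordEval B Y (a :: l)‖ ≤ μ ^ l.length * T ^ (l.length + 1) := by
  induction l with
  | nil => intro a; simpa [wordEval] using hY a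
  | cons b l ih =>
    intro a
    have hT : 0 ≤ T := (norm_nonneg _).trans (hY a)
    calc ‖wordEval B Y (a :: b :: l)‖ ≤ μ * ‖Y a‖ * ‖wordEval B Y (b :: l)‖ := hμ _ _
      _ ≤ μ * T * (μ ^ l.length * T ^ (l.length + 1)) := by
        gcongr
        · exact hY a
        · exact ih b
      _ = _ := by simp only [List.length_cons]; ring

lemma norm_wordEval_cons_sub_le (hμ0 : 0 ≤ μ) (hμ : ∀ x y : g, ‖B x y‖ ≤ μ * ‖x‖ * ‖y‖) {m : ℕ}
    {U V : Fin m → g} {T D : ℝ} (hU : ∀ a, ‖U a‖ ≤ T) (hV : ∀ a, ‖V a‖ ≤ T)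
    (hD : ∀ a, ‖U a - V a‖ ≤ D) (l : List (Fin m)) :
    ∀ a, ‖wordEval B U (a :: l) - wordEval B V (a :: l)‖
      ≤ (l.length + 1) * μ ^ l.length * D * T ^ l.length := by
  induction l with
  | nil => intro a; simpa [wordEval] using hD a
  | cons b l ih =>
    intro a
    have hT : 0 ≤ T := (norm_nonneg _).trans (hU a)
    have hD0 : 0 ≤ D := (norm_nonneg _).trans (hD a)
    have e : wordEval B U (a :: b :: l) - wordEval B V (a :: b :: l)
        = B (U a - V a) (wordEval B U (b :: l))
          + B (V a) (wordEval B U (b :: l) - wordEval B V (b :: l)) := by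
      simp [wordEval]
    rw [e]
    calc _ ≤ μ * ‖U a - V a‖ * ‖wordEval B U (b :: l)‖
          + μ * ‖V a‖ * ‖wordEval B U (b :: l) - wordEval B V (b :: l)‖ :=
        (norm_add_le _ _).trans (add_le_add (hμ _ _) (hμ _ _))
      _ ≤ μ * D * (μ ^ l.length * T ^ (l.length + 1))
          + μ * T * ((l.length + 1) * μ ^ l.length * D * T ^ l.length) := by
        gcongr
        · exact hD a
        · exact norm_wordEval_cons_le hμ0 hμ hU l b
        · exact hV a
        · exact ih b
      _ = _ := by simp only [List.length_cons]; push_cast; ring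

lemma exists_norm_wordSum_le (hμ0 : 0 ≤ μ) (hμ : ∀ x y : g, ‖B x y‖ ≤ μ * ‖x‖ * ‖y‖) {n r : ℕ}
    (c : Word (n + r) → Fin n → ℝ) (i : ℕ) :
    ∃ C, 0 ≤ C ∧ ∀ (X : Fin n → g) (W : Fin r → g) (T : ℝ), 1 ≤ T → ‖X‖ ≤ T → ‖W‖ ≤ T →
      ‖wordSum B c (i + 1) X W‖ ≤ C * ‖X‖ * T ^ i := by
  refine ⟨∑ ω ∈ shortWords (n + r) (i + 1), ‖c ω‖ * (ω.1.length * μ ^ (ω.1.length - 1)),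
    by positivity, fun X W T hT hX hW => ?_⟩
  have hT0 : 0 ≤ T := zero_le_one.trans hT
  refine (pi_norm_le_iff_of_nonneg (by positivity)).mpr fun j => ?_
  unfold wordSum
  rw [Finset.sum_mul, Finset.sum_mul]
  refine norm_sum_le_of_le _ fun ω hω => ?_
  rw [mem_shortWords] at hω
  obtain ⟨_ | ⟨a, l⟩, hl⟩ := ω
  · simp at hl
  simp only [List.length_cons] at hω
  have hdiff := norm_wordEval_cons_sub_le hμ0 hμ (norm_letter_le hX hW)
    (norm_letter_le (X := 0) (by simpa using hT0) hW) (norm_letter_sub_le X W) l a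
  have hTl : T ^ l.length ≤ T ^ i := pow_le_pow_right₀ hT (by omega)
  rw [norm_smul]
  calc _ ≤ ‖c ⟨a :: l, hl⟩‖ * ((l.length + 1) * μ ^ l.length * ‖X‖ * T ^ i) := by
        gcongr
        · exact norm_le_pi_norm (c ⟨a :: l, hl⟩) j
        · exact hdiff.trans (by gcongr)
    _ = _ := by simp only [List.length_cons, Nat.add_sub_cancel]; push_cast; ring

end estimates

section linear

variable {E : Type*} [NormedAddCommGroup E] [NormedSpace ℝ E]

lemma exists_norm_pow_le_of_specRad_lt (A : E →L[ℝ] E) {a : ℝ} (ha : 0 < a) (h : specRad A < a) :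
    ∃ C, 0 ≤ C ∧ ∀ k, ‖A ^ k‖ ≤ C * a ^ k := by
  have hbdd : Filter.IsBoundedUnder (· ≤ ·) Filter.atTop
      (fun k : ℕ => ‖A ^ k‖ ^ (1 / (k : ℝ))) := by
    refine Filter.isBoundedUnder_of_eventually_le (a := ‖A‖) ?_
    filter_upwards [Filter.eventually_ge_atTop 1] with k hk
    have hk' : k ≠ 0 := by omega
    calc ‖A ^ k‖ ^ (1 / (k : ℝ)) ≤ (‖A‖ ^ k) ^ (1 / (k : ℝ)) := by
          gcongr
          exact norm_pow_le' A hk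
      _ = ‖A‖ := by rw [one_div, Real.pow_rpow_inv_natCast (norm_nonneg _) hk']
  obtain ⟨N, hN⟩ := Filter.eventually_atTop.mp
    ((Filter.eventually_lt_of_limsup_lt h hbdd).and (Filter.eventually_ge_atTop 1))
  refine ⟨1 + ∑ k ∈ Finset.range N, ‖A ^ k‖ / a ^ k, by positivity, fun k => ?_⟩
  rw [← div_le_iff₀ (by positivity)]
  rcases lt_or_ge k N with hk | hk
  · have := Finset.single_le_sum (f := fun k => ‖A ^ k‖ / a ^ k) (fun _ _ => by positivity)
      (Finset.mem_range.mpr hk)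
    linarith
  · obtain ⟨h1, h2⟩ := hN k hk
    have hk' : k ≠ 0 := by omega
    have h3 : ‖A ^ k‖ ≤ a ^ k := by
      calc ‖A ^ k‖ = (‖A ^ k‖ ^ (1 / (k : ℝ))) ^ k := by
            rw [one_div, Real.rpow_inv_natCast_pow (norm_nonneg _) hk']
        _ ≤ a ^ k := by gcongr
    have h4 : ‖A ^ k‖ / a ^ k ≤ 1 := (div_le_one₀ (by positivity)).mpr h3
    have : 0 ≤ ∑ k ∈ Finset.range N, ‖A ^ k‖ / a ^ k := by positivity
    linarith

lemma sum_pow_mul_pow_le {a b : ℝ} (ha : 0 ≤ a) (hab : a < b) (k : ℕ) :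
    ∑ j ∈ Finset.range k, a ^ (k - 1 - j) * b ^ j ≤ b ^ k / (b - a) := by
  rw [le_div_iff₀ (sub_pos.mpr hab)]
  have h := Commute.geom_sum₂_mul (Commute.all b a) k
  have e : ∑ j ∈ Finset.range k, a ^ (k - 1 - j) * b ^ j
      = ∑ j ∈ Finset.range k, b ^ j * a ^ (k - 1 - j) :=
    Finset.sum_congr rfl fun _ _ => mul_comm _ _
  rw [e, h]
  linarith [pow_nonneg ha k]

/-- Perturbed linear recursions, modulo an invariant subspace. -/
lemma exists_approx_of_linear_recursion {A : E →L[ℝ] E} {S : Submodule ℝ E}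
    (hS : ∀ x ∈ S, A x ∈ S) {a b C K : ℝ} (ha : 0 ≤ a) (hab : a < b) (hC : 0 ≤ C) (hK : 0 ≤ K)
    (hA : ∀ k, ‖A ^ k‖ ≤ C * a ^ k) {X F G : ℕ → E} (hX : ∀ k, X (k + 1) = A (X k) + F k)
    (hFG : ∀ k, F k - G k ∈ S) (hG : ∀ k, ‖G k‖ ≤ K * b ^ k) (k : ℕ) :
    ∃ Y, X k - Y ∈ S ∧ ‖Y‖ ≤ C * (‖X 0‖ + K / (b - a)) * b ^ k := by
  refine ⟨(A ^ k) (X 0) + ∑ j ∈ Finset.range k, (A ^ (k - 1 - j)) (G j), ?_, ?_⟩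
  · induction k with
    | zero => simp
    | succ k ih =>
      have e : ∑ j ∈ Finset.range (k + 1), (A ^ (k + 1 - 1 - j)) (G j)
          = A (∑ j ∈ Finset.range k, (A ^ (k - 1 - j)) (G j)) + G k := by
        rw [Finset.sum_range_succ, map_sum]
        congr 1
        · refine Finset.sum_congr rfl fun j hj => ?_
          have : k + 1 - 1 - j = (k - 1 - j) + 1 := by
            have := Finset.mem_range.mp hj
            omega
          rw [this, pow_succ']
          rfl
        · simp
      have e' : X (k + 1) - ((A ^ (k + 1)) (X 0)
            + ∑ j ∈ Finset.range (k + 1), (A ^ (k + 1 - 1 - j)) (G j))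
          = A (X k - ((A ^ k) (X 0) + ∑ j ∈ Finset.range k, (A ^ (k - 1 - j)) (G j)))
            + (F k - G k) := by
        rw [e, hX, pow_succ', mul_apply_eq_comp, map_sub, map_add]
        abel
      rw [e']
      exact add_mem (hS _ ih) (hFG k)
  · have hb : 0 ≤ b := ha.trans hab.le
    calc ‖(A ^ k) (X 0) + ∑ j ∈ Finset.range k, (A ^ (k - 1 - j)) (G j)‖
        ≤ C * a ^ k * ‖X 0‖
          + ∑ j ∈ Finset.range k, C * a ^ (k - 1 - j) * (K * b ^ j) := by
          refine (norm_add_le _ _).trans (add_le_add ?_ (norm_sum_le_of_le _ fun j _ => ?_))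
          · exact ContinuousLinearMap.le_of_opNorm_le _ (hA k) _
          · exact (ContinuousLinearMap.le_of_opNorm_le _ (hA _) _).trans (mul_le_mul_of_nonneg_left (hG j) (by positivity))
      _ = C * a ^ k * ‖X 0‖
          + C * K * ∑ j ∈ Finset.range k, a ^ (k - 1 - j) * b ^ j := by
        rw [Finset.mul_sum]
        congr 1
        exact Finset.sum_congr rfl fun _ _ => by ring
      _ ≤ C * b ^ k * ‖X 0‖ + C * K * (b ^ k / (b - a)) := by
        gcongr
        exact sum_pow_mul_pow_le ha hab k
      _ = _ := by ring

end linear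

/-- For a nilpotent Lie algebra `g` with nilindex `p` and a class-𝒜 map `f`
with linear part `A`, unique equilibrium at the origin and dynamically invariant lower central
series, if `‖W[k]‖ ≤ β s^k` and `ρ(A) < s^{p(1-p)/2}`, then the origin is semiglobally
exponentially stable for `X[k+1] = f(X[k], W[k])`. -/
theorem statement0
    {g : Type*} [NormedAddCommGroup g] [NormedSpace ℝ g] [FiniteDimensional ℝ g]
    -- the Lie bracket and its compatibility with the norm
    (B : g →ₗ[ℝ] g →ₗ[ℝ] g)
    (hBalt : ∀ x : g, B x x = 0)
    (hBjac : ∀ x y z : g, B x (B y z) = B (B x y) z + B y (B x z))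
    (μ : ℝ) (hμpos : 0 < μ) (hμ : ∀ x y : g, ‖B x y‖ ≤ μ * ‖x‖ * ‖y‖)
    (n r : ℕ) (hn : 1 ≤ n) (hr : 1 ≤ r)
    -- `g` is nilpotent with nilindex `p`, i.e. `p` is least with `g^(p+1) = 0`
    (p : ℕ) (hnilp : lcs B (⊤ : Submodule ℝ g) p = ⊥)
    (hleast : ∀ q, lcs B (⊤ : Submodule ℝ g) q = ⊥ → p ≤ q)
    -- `f` belongs to class-𝒜 with linear part `A` and coefficients `c`
    (A : (Fin n → g) →L[ℝ] (Fin n → g))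
    (c : Word (n + r) → Fin n → ℝ)
    (f : (Fin n → g) → (Fin r → g) → (Fin n → g))
    (hsum : ∀ (X : Fin n → g) (W : Fin r → g) (j : Fin n),
      Summable (fun ω : Word (n + r) => ‖c ω j • wordEval B (letter X W) ω.1‖))
    (hfdef : ∀ X W j, f X W j = A X j + ∑' ω : Word (n + r), c ω j • wordEval B (letter X W) ω.1)
    (hclassA : ∃ ε > 0, ∀ (X : Fin n → g) (W : Fin r → g), pnorm X + pnorm W < ε →
      Summable (fun ω : Word (n + r) =>
        μ ^ (ω.1.length - 1) * ‖c ω‖ * (ω.1.map fun i => ‖letter X W i‖).prod))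
    -- (i) the origin is the unique equilibrium
    (heq : ∀ (W : Fin r → g) (X : Fin n → g), f X W = 0 ↔ X = 0)
    -- (ii) each `(g^(i))^n` is invariant under `f`
    (hinv : ∀ (i : ℕ) (X : Fin n → g) (W : Fin r → g),
      (∀ j, X j ∈ lcs B (⊤ : Submodule ℝ g) i) → ∀ j, f X W j ∈ lcs B (⊤ : Submodule ℝ g) i)
    -- the exogenous signal and the spectral radius condition
    (W : ℕ → Fin r → g) (β s : ℝ) (hβ : 0 ≤ β) (hs : 1 ≤ s)
    (hW : ∀ k, pnorm (W k) ≤ β * s ^ k)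
    (hρ : specRad A < s ^ (((p : ℝ) * (1 - (p : ℝ))) / 2)) :
    -- semiglobal exponential stability of the origin
    ∀ M > 0, ∃ α : ℝ, 0 ≤ α ∧ ∃ lam : ℝ, 0 ≤ lam ∧ lam < 1 ∧
      ∀ X : ℕ → Fin n → g, (∀ k, X (k + 1) = f (X k) (W k)) →
        pnorm (X 0) ≤ M → ∀ k, pnorm (X k) ≤ α * lam ^ k * pnorm (X 0) := by
  have hB : B.IsAlt := hBalt
  have hμ0 := hμpos.le
  have hs0 : 0 ≤ s := zero_le_one.trans hs
  have hspos : 0 < s := zero_lt_one.trans_le hs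
  have hfin : ∀ X W j, f X W j = A X j
      + ∑ ω ∈ shortWords (n + r) p, c ω j • wordEval B (letter X W) ω.1 := by
    intro X W j
    rw [hfdef, tsum_eq_sum]
    intro ω hω
    rw [mem_shortWords, not_le] at hω
    rw [wordEval_eq_zero hB hnilp _ hω, smul_zero]
  have hf : ∀ X W, f X W = A X + wordSum B c p X W := by
    intro X W
    ext j
    have h0 : ∑ ω ∈ shortWords (n + r) p, c ω j • wordEval B (letter 0 W) ω.1 = 0 := by
      have h := hfin 0 W j
      rw [(heq W 0).mpr rfl, map_zero] at h
      simpa using h.symm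
    rw [hfin, Pi.add_apply, wordSum]
    simp only [smul_sub, Finset.sum_sub_distrib, h0, sub_zero]
  have hAinv : ∀ i, ∀ X ∈ Submodule.pi Set.univ (fun _ : Fin n => lcs B ⊤ i),
      A X ∈ Submodule.pi Set.univ (fun _ : Fin n => lcs B ⊤ i) := by
    intro i X hX j _
    have hX' : ∀ j, X j ∈ lcs B ⊤ i := fun j => hX j trivial
    have h := hinv i X 0 hX' j
    rw [hfin] at h
    refine (Submodule.add_mem_iff_left _ (sum_mem fun ω _ => Submodule.smul_mem _ _ ?_)).mp h
    have h2 := wordEval_sub_mem hB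
      (letter_sub_mem (Y := 0) (0 : Fin r → g) fun j => by simpa using hX' j) ω
    rw [letter_zero, wordEval_zero, sub_zero] at h2
    exact lcs_succ_le B i h2
  intro M hM
  have hbpos : 0 < s ^ (((p : ℝ) * (1 - (p : ℝ))) / 2) := Real.rpow_pos_of_pos hspos _
  obtain ⟨a, ha1, ha2⟩ := exists_between (max_lt hρ hbpos)
  obtain ⟨b, hab, hb2⟩ := exists_between ha2
  obtain ⟨hρa, ha⟩ := max_lt_iff.mp ha1
  have hb : 0 < b := ha.trans hab
  obtain ⟨C, hC, hA⟩ := exists_norm_pow_le_of_specRad_lt A ha hρa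
  set R : ℕ → ℝ := fun i => b * s ^ (∑ j ∈ Finset.range i, j) with hR
  have hR0 : ∀ i, 0 ≤ R i := fun i => by positivity
  have hbR : ∀ i, b ≤ R i := fun i => le_mul_of_one_le_right hb.le (one_le_pow₀ hs)
  have hRsucc : ∀ i, R (i + 1) = R i * s ^ i := fun i => by
    simp only [hR, Finset.sum_range_succ, pow_add, mul_assoc]
  have hRmono : Monotone R := monotone_nat_of_le_succ fun i => by
    rw [hRsucc]
    exact le_mul_of_one_le_right (hR0 i) (one_le_pow₀ hs)
  have hRp : R p < 1 := by
    have e : ((∑ j ∈ Finset.range p, j : ℕ) : ℝ) = -(((p : ℝ) * (1 - (p : ℝ))) / 2) := by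
      have h := Finset.sum_range_id_mul_two p
      cases p with
      | zero => simp
      | succ q =>
        have h' : ((∑ j ∈ Finset.range (q + 1), j : ℕ) : ℝ) * 2 = (q + 1) * q := by
          exact_mod_cast h
        push_cast at h' ⊢
        linarith
    have hpos := Real.rpow_pos_of_pos hspos (-(((p : ℝ) * (1 - (p : ℝ))) / 2))
    calc R p = b * s ^ (-(((p : ℝ) * (1 - (p : ℝ))) / 2)) := by
          rw [← e, Real.rpow_natCast]
      _ < s ^ (((p : ℝ) * (1 - (p : ℝ))) / 2) * s ^ (-(((p : ℝ) * (1 - (p : ℝ))) / 2)) := by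
          gcongr
      _ = 1 := by rw [← Real.rpow_add hspos, add_neg_cancel, Real.rpow_zero]
  have main : ∀ i ≤ p, ∃ α, 0 ≤ α ∧ ∀ X : ℕ → Fin n → g,
      (∀ k, X (k + 1) = f (X k) (W k)) → pnorm (X 0) ≤ M → ∀ k,
        ∃ Y, X k - Y ∈ Submodule.pi Set.univ (fun _ : Fin n => lcs B ⊤ i) ∧
          ‖Y‖ ≤ α * R i ^ k * ‖X 0‖ := by
    intro i
    induction i with
    | zero =>
      intro _
      exact ⟨0, le_rfl, fun X _ _ k => ⟨0, fun _ _ => trivial, by simp⟩⟩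
    | succ i ih =>
      intro hip
      obtain ⟨α, hα, hα'⟩ := ih (by omega)
      obtain ⟨D, hD, hD'⟩ := exists_norm_wordSum_le hμ0 hμ c i
      have hRi : R i ≤ 1 := (hRmono (by omega : i ≤ p)).trans hRp.le
      have haR : a < R (i + 1) := hab.trans_le (hbR _)
      have hgap : 0 < R (i + 1) - a := sub_pos.mpr haR
      set τ := 1 + β + α * M with hτ
      have hτ1 : 1 ≤ τ := by
        have : 0 ≤ α * M := by positivity
        linarith
      refine ⟨C * (1 + D * α * τ ^ i / (R (i + 1) - a)), by positivity, fun X hX hXM k => ?_⟩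
      choose Y hYmem hYle using hα' X hX hXM
      have hX0 : ‖X 0‖ ≤ M := (norm_le_pnorm _).trans hXM
      have hG : ∀ k, ‖wordSum B c (i + 1) (Y k) (W k)‖
          ≤ (D * α * τ ^ i * ‖X 0‖) * R (i + 1) ^ k := by
        intro k
        have hsk : 1 ≤ s ^ k := one_le_pow₀ hs
        have hYτ : ‖Y k‖ ≤ τ * s ^ k := by
          calc ‖Y k‖ ≤ α * R i ^ k * ‖X 0‖ := hYle k
            _ ≤ α * 1 * M := by
              gcongr
              exact pow_le_one₀ (hR0 i) hRi
            _ ≤ τ * 1 := by linarith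
            _ ≤ τ * s ^ k := by gcongr
        have hWτ : ‖W k‖ ≤ τ * s ^ k := by
          refine ((norm_le_pnorm _).trans (hW k)).trans ?_
          gcongr
          have : 0 ≤ α * M := by positivity
          linarith
        have hT : 1 ≤ τ * s ^ k := one_le_mul_of_one_le_of_one_le hτ1 hsk
        calc _ ≤ D * ‖Y k‖ * (τ * s ^ k) ^ i := hD' _ _ _ hT hYτ hWτ
          _ ≤ D * (α * R i ^ k * ‖X 0‖) * (τ * s ^ k) ^ i := by
            gcongr
            exact hYle k
          _ = _ := by
            rw [hRsucc, mul_pow τ, mul_pow (R i), ← pow_mul s k i, ← pow_mul s i k, mul_comm k i]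
            ring
      obtain ⟨Z, hZ, hZ'⟩ := exists_approx_of_linear_recursion (hAinv (i + 1)) ha.le haR hC
        (by positivity) hA (X := X) (F := fun k => wordSum B c p (X k) (W k))
        (G := fun k => wordSum B c (i + 1) (Y k) (W k)) (fun k => by rw [hX, hf])
        (fun k j _ => wordSum_sub_mem hB c hip (W k) (fun j => hYmem k j trivial) j) hG k
      exact ⟨Z, hZ, hZ'.trans_eq (by ring)⟩
  obtain ⟨α, hα, hα'⟩ := main p le_rfl
  refine ⟨n * α, by positivity, R p, hR0 p, hRp, fun X hX hXM k => ?_⟩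
  obtain ⟨Y, hY, hYle⟩ := hα' X hX hXM k
  have hXY : X k = Y := by
    ext j
    have h := hY j trivial
    simpa [hnilp, sub_eq_zero] using h
  have hRk : 0 ≤ R p ^ k := pow_nonneg (hR0 p) k
  calc pnorm (X k) ≤ n * ‖X k‖ := pnorm_le _
    _ ≤ n * (α * R p ^ k * pnorm (X 0)) := by
      rw [hXY]
      gcongr
      exact hYle.trans (by gcongr; exact norm_le_pnorm _)
    _ = _ := by ring
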